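/- Start the chain Ẑ from (0,0). Then almost surely there exist infinitely many n ≥ 1 for which the event A_n ∩ B_n occurs. (Via the Kenyon–Miller–Sheffield–Wilson encoding, this is equivalent to the statement that the uniform infinite quarter-plane bipolar-oriented triangulation almost surely has infinitely many cut vertices.) -/

import Mathlib

open MeasureTheory

/-- Transition probabilities of the conditioned walk `Ẑ` on `ℕ × ℤ`
(the Doob h-transform, with harmonic function `h(x,y) = x + 1`, of the walk with i.i.d.
increments uniform on `{(1,-1), (-1,0), (0,1)}`). -/
noncomputable def transProb : ℕ × ℤ → ℕ × ℤ → ℝ := fun p q =>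
  if q.1 = p.1 + 1 ∧ q.2 = p.2 - 1 then ((p.1 : ℝ) + 2) / (3 * ((p.1 : ℝ) + 1))
  else if q.1 + 1 = p.1 ∧ q.2 = p.2 then (p.1 : ℝ) / (3 * ((p.1 : ℝ) + 1))
  else if q.1 = p.1 ∧ q.2 = p.2 + 1 then 1 / 3
  else 0

open scoped ENNReal
open Filter Topology

namespace BipolarWalk

/-- First coordinate of the steps `(1,-1)`, `(-1,0)`, `(0,1)`. -/
def stepX : Fin 3 → ℤ := ![1, -1, 0]

/-- Second coordinate of the steps `(1,-1)`, `(-1,0)`, `(0,1)`. -/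
def stepY : Fin 3 → ℤ := ![-1, 0, 1]

/-- First coordinate of the endpoint of a word of steps. -/
def posX (w : List (Fin 3)) : ℤ := (w.map stepX).sum

/-- Second coordinate of the endpoint of a word of steps. -/
def posY (w : List (Fin 3)) : ℤ := (w.map stepY).sum

@[simp] lemma posX_nil : posX [] = 0 := rfl
@[simp] lemma posY_nil : posY [] = 0 := rfl
@[simp] lemma posX_cons (a : Fin 3) (w : List (Fin 3)) : posX (a :: w) = stepX a + posX w := by
  simp [posX]
@[simp] lemma posY_cons (a : Fin 3) (w : List (Fin 3)) : posY (a :: w) = stepY a + posY w := by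
  simp [posY]
@[simp] lemma posX_append (v w : List (Fin 3)) : posX (v ++ w) = posX v + posX w := by
  simp [posX]
@[simp] lemma posY_append (v w : List (Fin 3)) : posY (v ++ w) = posY v + posY w := by
  simp [posY]

/-- The probability of a word under the uniform step distribution. -/
noncomputable def weight (w : List (Fin 3)) : ℝ≥0∞ := 3⁻¹ ^ w.length

@[simp] lemma weight_nil : weight [] = 1 := by simp [weight]

lemma weight_cons (a : Fin 3) (w : List (Fin 3)) : weight (a :: w) = 3⁻¹ * weight w := by
  simp [weight, pow_succ']

lemma weight_append (v w : List (Fin 3)) : weight (v ++ w) = weight v * weight w := by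
  simp [weight, pow_add]

lemma weight_ne_top (w : List (Fin 3)) : weight w ≠ ∞ := by
  simp [weight]

/-- The first coordinate stays non-negative along the word. -/
def StaysNonneg (w : List (Fin 3)) : Prop := ∀ j ≤ w.length, 0 ≤ posX (w.take j)

/-- The first coordinate stays non-negative, and the second one attains a strict minimum at the
end of the word. -/
def IsRenewal (w : List (Fin 3)) : Prop :=
  StaysNonneg w ∧ ∀ j < w.length, posY w < posY (w.take j)

/-- A nonempty renewal word which is not a product of nonempty renewal words. -/
def IsPrimeRenewal (w : List (Fin 3)) : Prop :=
  IsRenewal w ∧ w ≠ [] ∧ ∀ u v, u ≠ [] → v ≠ [] → IsRenewal u → IsRenewal v → w ≠ u ++ v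

lemma StaysNonneg.posX_nonneg {w : List (Fin 3)} (h : StaysNonneg w) : 0 ≤ posX w := by
  simpa using h w.length le_rfl

lemma staysNonneg_append {v w : List (Fin 3)} (hv : StaysNonneg v)
    (hw : ∀ j ≤ w.length, 0 ≤ posX v + posX (w.take j)) : StaysNonneg (v ++ w) := by
  intro j hj
  rw [List.length_append] at hj
  rcases le_total j v.length with h | h
  · rw [List.take_append_of_le_length h]
    exact hv j h
  · obtain ⟨i, rfl⟩ := Nat.exists_eq_add_of_le h
    rw [List.take_length_add_append, posX_append]
    exact hw i (by omega)

lemma isRenewal_append {v w : List (Fin 3)} (hv : IsRenewal v) (hw : IsRenewal w) :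
    IsRenewal (v ++ w) := by
  refine ⟨staysNonneg_append hv.1 fun j hj => add_nonneg hv.1.posX_nonneg (hw.1 j hj), ?_⟩
  intro j hj
  rw [List.length_append] at hj
  have hy : posY w ≤ 0 := by
    rcases Nat.eq_zero_or_pos w.length with h | h
    · rw [List.length_eq_zero_iff.1 h]; simp
    · simpa using (hw.2 0 h).le
  rw [posY_append]
  rcases lt_or_ge j v.length with h | h
  · rw [List.take_append_of_le_length h.le]
    have := hv.2 j h
    omega
  · obtain ⟨i, rfl⟩ := Nat.exists_eq_add_of_le h
    rw [List.take_length_add_append, posY_append]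
    have := hw.2 i (by omega)
    omega

lemma isRenewal_right_of_append {v w : List (Fin 3)} (h : IsRenewal (v ++ w))
    (hw : StaysNonneg w) : IsRenewal w := by
  refine ⟨hw, fun j hj => ?_⟩
  have := h.2 (v.length + j) (by simpa using hj)
  rw [List.take_length_add_append, posY_append, posY_append] at this
  omega

lemma IsRenewal.exists_prime_append {w : List (Fin 3)} (hw : IsRenewal w) (hne : w ≠ []) :
    ∃ p r, IsPrimeRenewal p ∧ IsRenewal r ∧ w = p ++ r := by
  induction hn : w.length using Nat.strong_induction_on generalizing w with
  | _ n ih =>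
    by_cases hp : IsPrimeRenewal w
    · exact ⟨w, [], hp, ⟨by simp [StaysNonneg], by simp⟩, by simp⟩
    · simp only [IsPrimeRenewal, not_and, not_forall, not_not] at hp
      obtain ⟨u, v, hu, hv, hru, hrv, rfl⟩ := hp hw hne
      have hl : u.length < n := by
        have := List.length_pos_iff.2 hv
        simp at hn
        omega
      obtain ⟨p, r, h1, h2, rfl⟩ := ih _ hl hru hu rfl
      exact ⟨p, r ++ v, h1, isRenewal_append h2 hrv, by simp⟩

/-- From `(x, y)`, the word leads to the first visit of the axis `y = 0`, without the first
coordinate becoming negative. -/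
def HitsAxis (x y : ℤ) (w : List (Fin 3)) : Prop :=
  (∀ j ≤ w.length, 0 ≤ x + posX (w.take j)) ∧ (∀ j < w.length, 0 < y + posY (w.take j)) ∧
    y + posY w = 0

lemma HitsAxis.cons {x y : ℤ} {a : Fin 3} {w : List (Fin 3)} (hx : 0 ≤ x) (hy : 0 < y)
    (h : HitsAxis (x + stepX a) (y + stepY a) w) : HitsAxis x y (a :: w) := by
  obtain ⟨h1, h2, h3⟩ := h
  refine ⟨?_, ?_, by rw [posY_cons]; omega⟩
  · rintro (_ | j) hj
    · simpa using hx
    · have := h1 j (by simpa using hj)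
      simp only [List.take_succ_cons, posX_cons]
      omega
  · rintro (_ | j) hj
    · simpa using hy
    · have := h2 j (by simpa using hj)
      simp only [List.take_succ_cons, posY_cons]
      omega

open Classical in
/-- The probability that the unconditioned walk from `(x, y)` reaches the axis `y = 0` before
its first coordinate becomes negative. -/
noncomputable def hitProb (x y : ℤ) : ℝ≥0∞ := ∑' w, if HitsAxis x y w then weight w else 0

lemma one_le_hitProb {x : ℤ} (hx : 0 ≤ x) : 1 ≤ hitProb x 0 := by
  classical
  refine le_trans ?_ (ENNReal.le_tsum ([] : List (Fin 3)))
  simp [HitsAxis, hx]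

lemma sum_hitProb_le {x y : ℤ} (hx : 0 ≤ x) (hy : 0 < y) :
    3⁻¹ * (hitProb (x + 1) (y - 1) + hitProb (x - 1) y + hitProb x (y + 1)) ≤ hitProb x y := by
  classical
  have hinj : Function.Injective (fun q : Fin 3 × List (Fin 3) => q.1 :: q.2) := by
    rintro ⟨a, v⟩ ⟨b, w⟩ h
    simpa using h
  have key := ENNReal.tsum_comp_le_tsum_of_injective hinj
    (fun w => if HitsAxis x y w then weight w else 0)
  refine le_trans ?_ key
  rw [ENNReal.tsum_prod', tsum_fintype]
  have hstep : ∀ a : Fin 3, 3⁻¹ * hitProb (x + stepX a) (y + stepY a) ≤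
      ∑' w, if HitsAxis x y (a :: w) then weight (a :: w) else 0 := by
    intro a
    rw [hitProb, ← ENNReal.tsum_mul_left]
    refine ENNReal.tsum_le_tsum fun w => ?_
    split_ifs with h1 h2
    · rw [weight_cons]
    · exact absurd (h1.cons hx hy) h2
    · simp
    · simp
  calc _ = ∑ a : Fin 3, 3⁻¹ * hitProb (x + stepX a) (y + stepY a) := by
        simp [Fin.sum_univ_three, stepX, stepY, mul_add, sub_eq_add_neg]
    _ ≤ _ := Finset.sum_le_sum fun a _ => hstep a

lemma min_hitProb_superharmonic {x y : ℤ} (hx : 0 ≤ x) (hy : 0 < y) :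
    ((min (hitProb (x + 1) (y - 1)) 1).toReal + (min (hitProb (x - 1) y) 1).toReal +
      (min (hitProb x (y + 1)) 1).toReal) / 3 ≤ (min (hitProb x y) 1).toReal := by
  have hfin : ∀ a : ℝ≥0∞, min a 1 ≠ ∞ := fun a => by simp
  have h : 3⁻¹ * (min (hitProb (x + 1) (y - 1)) 1 + min (hitProb (x - 1) y) 1 +
      min (hitProb x (y + 1)) 1) ≤ min (hitProb x y) 1 := by
    refine le_min (le_trans ?_ (sum_hitProb_le hx hy)) ?_
    · gcongr <;> exact min_le_left _ _
    · calc _ ≤ (3⁻¹ : ℝ≥0∞) * (1 + 1 + 1) := by gcongr <;> exact min_le_right _ _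
        _ = 1 := by
          rw [show (1 + 1 + 1 : ℝ≥0∞) = 3 by norm_num]
          exact ENNReal.inv_mul_cancel (by norm_num) (by norm_num)
  have h2 := ENNReal.toReal_mono (hfin _) h
  rw [ENNReal.toReal_mul, ENNReal.toReal_add (by simp) (hfin _),
    ENNReal.toReal_add (hfin _) (hfin _), ENNReal.toReal_inv] at h2
  norm_num at h2 ⊢
  linarith

/-- Comparison with the subharmonic function `(x + 1) (8 k - 4 y - x)`, which is positive on a
triangle only. -/
lemma inv_le_hitProb (k : ℕ) (hk : 1 ≤ k) : (6 * (k : ℝ≥0∞))⁻¹ ≤ hitProb 0 k := by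
  have hkR : (1 : ℝ) ≤ k := by exact_mod_cast hk
  set f : ℤ → ℤ → ℝ := fun x y => (min (hitProb x y) 1).toReal with hf
  set g : ℤ → ℤ → ℝ := fun x y => ((x : ℝ) + 1) * (8 * k - 4 * y - x) with hg
  have hf0 : ∀ x y, 0 ≤ f x y := fun x y => ENNReal.toReal_nonneg
  have hf1 : ∀ x, 0 ≤ x → f x 0 = 1 := fun x hx => by
    simp [hf, min_eq_right (one_le_hitProb hx)]
  set φ : ℤ → ℤ → ℝ := fun x y => g x y - 24 * k ^ 2 * f x y with hφ
  set s : Finset (ℤ × ℤ) := Finset.Icc 0 (8 * (k : ℤ)) ×ˢ Finset.Icc 1 (8 * (k : ℤ)) with hs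
  have hmem : ((0 : ℤ), (k : ℤ)) ∈ s := by
    simp only [hs, Finset.mem_product, Finset.mem_Icc]
    omega
  have hout : ∀ x y : ℤ, -1 ≤ x → 0 ≤ y → (x, y) ∉ s → φ x y ≤ 0 := by
    intro x y hx hy hxy
    rcases eq_or_lt_of_le hx with rfl | hx
    · have := hf0 (-1) y
      simp only [hφ, hg]
      push_cast
      nlinarith [mul_nonneg (by positivity : (0 : ℝ) ≤ 24 * (k : ℝ) ^ 2) this]
    have hx : 0 ≤ x := by omega
    have hxR : (0 : ℝ) ≤ x := by exact_mod_cast hx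
    rcases eq_or_lt_of_le hy with rfl | hy
    · simp only [hφ, hg, hf1 x hx]
      push_cast
      nlinarith [sq_nonneg ((x : ℝ) + 1 - (8 * k - x))]
    · have hyR : (0 : ℝ) < y := by exact_mod_cast hy
      have hlarge : 8 * (k : ℤ) < x ∨ 8 * (k : ℤ) < y := by
        simp only [hs, Finset.mem_product, Finset.mem_Icc] at hxy
        omega
      have : (8 * k - 4 * y - x : ℝ) ≤ 0 := by
        rcases hlarge with h | h
        · have : (8 * k : ℝ) < x := by exact_mod_cast h
          linarith
        · have : (8 * k : ℝ) < y := by exact_mod_cast h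
          linarith
      have h2 := mul_nonneg (by positivity : (0 : ℝ) ≤ 24 * (k : ℝ) ^ 2) (hf0 x y)
      simp only [hφ, hg]
      nlinarith
  obtain ⟨⟨x, y⟩, hxy, hmax⟩ := s.exists_max_image (fun q => φ q.1 q.2) ⟨_, hmem⟩
  have hle : φ x y ≤ 0 := by
    by_contra! hpos
    have hnb : ∀ x' y' : ℤ, -1 ≤ x' → 0 ≤ y' → φ x' y' ≤ φ x y := fun x' y' h1 h2 => by
      by_cases h : (x', y') ∈ s
      · exact hmax _ h
      · exact (hout x' y' h1 h2 h).trans hpos.le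
    simp only [hs, Finset.mem_product, Finset.mem_Icc] at hxy
    have h1 := hnb (x + 1) (y - 1) (by omega) (by omega)
    have h2 := hnb (x - 1) y (by omega) (by omega)
    have h3 := hnb x (y + 1) (by omega) (by omega)
    have hsup : (f (x + 1) (y - 1) + f (x - 1) y + f x (y + 1)) / 3 ≤ f x y :=
      min_hitProb_superharmonic (by omega) (by omega)
    have hsup' := mul_le_mul_of_nonneg_left hsup (by positivity : (0 : ℝ) ≤ 24 * (k : ℝ) ^ 2)
    simp only [hφ, hg] at h1 h2 h3
    push_cast at h1 h2 h3
    nlinarith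
  have h0 : φ 0 k ≤ 0 := (hmax _ hmem).trans hle
  have hfk : (6 * (k : ℝ))⁻¹ ≤ f 0 k := by
    simp only [hφ, hg] at h0
    push_cast at h0
    rw [inv_le_iff_one_le_mul₀ (by positivity)]
    have : (k : ℝ) * 1 ≤ k * (f 0 k * (6 * k)) := by nlinarith
    exact le_of_mul_le_mul_left this (by positivity)
  have h3 := ENNReal.ofReal_le_ofReal hfk
  rw [hf, ENNReal.ofReal_toReal (by simp), ENNReal.ofReal_inv_of_pos (by positivity),
    ENNReal.ofReal_mul (by norm_num), ENNReal.ofReal_natCast] at h3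
  norm_num at h3
  simpa using h3.1

open Classical in
lemma tsum_isRenewal_eq_top : ∑' w, (if IsRenewal w then weight w else 0) = ∞ := by
  have hle : ∑' k : ℕ, hitProb 0 ((k + 1 : ℕ) : ℤ) ≤
      ∑' w, (if IsRenewal w then weight w else 0) := by
    simp only [hitProb]
    rw [ENNReal.tsum_comm]
    refine ENNReal.tsum_le_tsum fun w => ?_
    by_cases h : ∃ k : ℕ, HitsAxis 0 ((k + 1 : ℕ) : ℤ) w
    · obtain ⟨k, hk⟩ := h
      have hr : IsRenewal w := by
        obtain ⟨h1, h2, h3⟩ := hk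
        refine ⟨fun j hj => by simpa using h1 j hj, fun j hj => ?_⟩
        have := h2 j hj
        omega
      rw [tsum_eq_single k, if_pos hk, if_pos hr]
      intro l hl
      rw [if_neg]
      intro hl'
      have h1 := hk.2.2
      have h2 := hl'.2.2
      push_cast at h1 h2
      omega
    · rw [not_exists] at h
      rw [ENNReal.tsum_eq_zero.2 fun k => if_neg (h k)]
      exact zero_le
  have hdiv : ∑' k : ℕ, (6 * ((k + 1 : ℕ) : ℝ≥0∞))⁻¹ = ∞ := by
    have hns : ¬ Summable fun k : ℕ => (6 * ((k + 1 : ℕ) : ℝ))⁻¹ := by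
      simp only [mul_inv]
      rw [summable_mul_left_iff (by norm_num)]
      rw [summable_nat_add_iff 1 (f := fun k : ℕ => (k : ℝ)⁻¹)]
      exact Real.not_summable_natCast_inv
    by_contra hne
    apply hns
    have := ENNReal.summable_toReal hne
    refine this.congr fun k => ?_
    rw [ENNReal.toReal_inv, ENNReal.toReal_mul, ENNReal.toReal_natCast, ENNReal.toReal_ofNat]
  refine top_unique (hdiv ▸ le_trans (ENNReal.tsum_le_tsum fun k => ?_) hle)
  exact inv_le_hitProb (k + 1) (by omega)

open Classical in
lemma one_le_tsum_isPrimeRenewal : 1 ≤ ∑' w, (if IsPrimeRenewal w then weight w else 0) := by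
  set F := ∑' w, (if IsPrimeRenewal w then weight w else 0) with hF
  by_contra! hlt
  set G : ℕ → ℝ≥0∞ := fun N =>
    ∑' w, (if IsRenewal w ∧ w.length ≤ N then weight w else 0) with hG
  have hGfin : ∀ N, G N ≠ ∞ := by
    intro N
    have hfin := List.finite_length_le (Fin 3) N
    simp only [hG]
    rw [tsum_eq_sum (s := hfin.toFinset)]
    · refine ENNReal.sum_ne_top.2 fun w _ => ?_
      split_ifs
      · exact weight_ne_top w
      · simp
    · intro w hw
      rw [if_neg]
      simpa using fun _ => not_le.1 fun h => hw (hfin.mem_toFinset.2 h)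
  have hGle : ∀ N, G N ≤ 1 + F * G N := by
    intro N
    choose! p r hp hr hpr using fun w (h : IsRenewal w ∧ w ≠ []) => h.1.exists_prime_append h.2
    have hinj : Function.Injective (fun w : {w // IsRenewal w ∧ w ≠ []} => (p w.1, r w.1)) := by
      intro u v huv
      simp only [Prod.mk.injEq] at huv
      apply Subtype.ext
      rw [hpr u.1 u.2, hpr v.1 v.2, huv.1, huv.2]
    calc G N ≤ ∑' w, ((if w = [] then 1 else 0) +
          {w | IsRenewal w ∧ w ≠ []}.indicator
            (fun w => if w.length ≤ N then weight w else 0) w) := by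
          refine ENNReal.tsum_le_tsum fun w => ?_
          by_cases hw : w = []
          · subst hw
            rw [if_pos rfl]
            split_ifs <;> simp
          · by_cases h : IsRenewal w <;> simp [hw, h, Set.indicator]
      _ = 1 + ∑' w : {w // IsRenewal w ∧ w ≠ []},
            (if w.1.length ≤ N then weight w.1 else 0) := by
          rw [ENNReal.tsum_add, tsum_ite_eq, ← tsum_subtype]
          rfl
      _ ≤ 1 + ∑' w : {w // IsRenewal w ∧ w ≠ []},
            (fun q : List (Fin 3) × List (Fin 3) => (if IsPrimeRenewal q.1 then weight q.1 else 0) *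
              (if IsRenewal q.2 ∧ q.2.length ≤ N then weight q.2 else 0)) (p w.1, r w.1) := by
          gcongr with w
          split_ifs with h1
          · have hlen : (r w.1).length ≤ N := by
              have := congrArg List.length (hpr w.1 w.2)
              rw [List.length_append] at this
              omega
            simp only [if_pos (hp w.1 w.2), if_pos (And.intro (hr w.1 w.2) hlen)]
            rw [← weight_append, ← hpr w.1 w.2]
          · exact zero_le
      _ ≤ 1 + ∑' q : List (Fin 3) × List (Fin 3),
            (if IsPrimeRenewal q.1 then weight q.1 else 0) *
              (if IsRenewal q.2 ∧ q.2.length ≤ N then weight q.2 else 0) := by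
          gcongr
          exact ENNReal.tsum_comp_le_tsum_of_injective hinj _
      _ = 1 + F * G N := by
          rw [ENNReal.tsum_prod']
          simp only [ENNReal.tsum_mul_left, ENNReal.tsum_mul_right]
          rfl
  have hGbound : ∀ N, G N ≤ (1 - F)⁻¹ := by
    intro N
    rw [← one_div, ENNReal.le_div_iff_mul_le (Or.inl (tsub_pos_of_lt hlt).ne')
      (Or.inl (by simp)), mul_comm, ENNReal.sub_mul (fun _ _ => hGfin N), one_mul]
    exact tsub_le_iff_right.2 (hGle N)
  have htop : (∞ : ℝ≥0∞) ≤ (1 - F)⁻¹ := by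
    rw [← tsum_isRenewal_eq_top, ENNReal.tsum_eq_iSup_sum]
    refine iSup_le fun s => le_trans ?_ (hGbound (s.sup List.length))
    refine le_trans (Finset.sum_le_sum fun w hw => ?_) (ENNReal.sum_le_tsum s)
    simp [Finset.le_sup hw]
  rw [top_le_iff, ENNReal.inv_eq_top] at htop
  exact (tsub_pos_of_lt hlt).ne' htop

/-- The probability that the first coordinate of the unconditioned walk, started from `d`, stays
non-negative for `M` steps. -/
noncomputable def survival : ℕ → ℤ → ℝ
  | 0, d => if 0 ≤ d then 1 else 0
  | M + 1, d => if 0 ≤ d then (survival M (d + 1) + survival M (d - 1) + survival M d) / 3 else 0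

lemma survival_of_neg {d : ℤ} (hd : d < 0) (M : ℕ) : survival M d = 0 := by
  cases M <;> simp [survival, hd]

lemma survival_nonneg (M : ℕ) (d : ℤ) : 0 ≤ survival M d := by
  induction M generalizing d with
  | zero => simp only [survival]; split_ifs <;> norm_num
  | succ M ih =>
    simp only [survival]
    split_ifs
    · linarith [ih (d + 1), ih (d - 1), ih d]
    · exact le_rfl

lemma survival_le_one (M : ℕ) (d : ℤ) : survival M d ≤ 1 := by
  induction M generalizing d with
  | zero => simp only [survival]; split_ifs <;> norm_num
  | succ M ih =>
    simp only [survival]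
    split_ifs
    · linarith [ih (d + 1), ih (d - 1), ih d]
    · norm_num

lemma survival_succ_le (M : ℕ) (d : ℤ) : survival (M + 1) d ≤ survival M d := by
  induction M generalizing d with
  | zero =>
    by_cases hd : 0 ≤ d
    · have h : survival 0 d = 1 := by simp [survival, hd]
      exact h ▸ survival_le_one _ _
    · rw [survival_of_neg (not_le.1 hd), survival_of_neg (not_le.1 hd)]
  | succ M ih =>
    by_cases hd : 0 ≤ d
    · rw [survival, if_pos hd]
      nth_rw 4 [survival]
      rw [if_pos hd]
      linarith [ih (d + 1), ih (d - 1), ih d]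
    · rw [survival_of_neg (not_le.1 hd), survival_of_neg (not_le.1 hd)]

lemma tendsto_survival_zero : Tendsto (fun M => survival M 0) atTop (𝓝 0) := by
  have hlim : ∀ d, ∃ l, Tendsto (fun M => survival M d) atTop (𝓝 l) := fun d =>
    ⟨_, tendsto_atTop_ciInf (antitone_nat_of_succ_le fun M => survival_succ_le M d)
      ⟨0, by rintro _ ⟨M, rfl⟩; exact survival_nonneg M d⟩⟩
  choose l hl using hlim
  have hneg : l (-1) = 0 := tendsto_nhds_unique (hl (-1)) <| by
    simpa only [survival_of_neg (show (-1 : ℤ) < 0 by norm_num)] using tendsto_const_nhds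
  have hrec : ∀ d : ℤ, 0 ≤ d → l (d + 1) = 2 * l d - l (d - 1) := by
    intro d hd
    have h1 := (tendsto_add_atTop_iff_nat 1).2 (hl d)
    simp only [survival, if_pos hd] at h1
    have h2 := (((hl (d + 1)).add (hl (d - 1))).add (hl d)).div_const 3
    have := tendsto_nhds_unique h1 h2
    linarith
  have hlin : ∀ n : ℕ, l n = (n + 1) * l 0 ∧ l ((n : ℤ) - 1) = n * l 0 := by
    intro n
    induction n with
    | zero => simp [hneg]
    | succ n ih =>
      have h := hrec n (by omega)
      push_cast
      refine ⟨by rw [h, ih.1, ih.2]; ring, by rw [add_sub_cancel_right, ih.1]⟩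
  have h0 : 0 ≤ l 0 := ge_of_tendsto' (hl 0) fun M => survival_nonneg M 0
  have h1 : l 0 = 0 := by
    by_contra hne
    have hpos : 0 < l 0 := lt_of_le_of_ne h0 (Ne.symm hne)
    obtain ⟨n, hn⟩ := exists_nat_gt (1 / l 0)
    rw [div_lt_iff₀ hpos] at hn
    have h2 : l n ≤ 1 := le_of_tendsto' (hl n) fun M => survival_le_one M n
    rw [(hlin n).1] at h2
    linarith
  exact h1 ▸ hl 0

section Chain

variable {Ω : Type*} {Z : ℕ → Ω → ℕ × ℤ}

/-- The event that the chain starts from the origin and makes the steps of the word `w`. -/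
def follow (Z : ℕ → Ω → ℕ × ℤ) (w : List (Fin 3)) : Set Ω :=
  {ω | ∀ j ≤ w.length, ((Z j ω).1 : ℤ) = posX (w.take j) ∧ (Z j ω).2 = posY (w.take j)}

/-- The event that the first coordinate is at least `c` during the times `n, …, n + M`. -/
def stayAbove (Z : ℕ → Ω → ℕ × ℤ) (c : ℤ) (n M : ℕ) : Set Ω :=
  {ω | ∀ j, n ≤ j → j ≤ n + M → c ≤ ((Z j ω).1 : ℤ)}

/-- The event that the first coordinate never goes below its value at time `n` afterwards. -/
def futureMin (Z : ℕ → Ω → ℕ × ℤ) (n : ℕ) : Set Ω :=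
  {ω | ∀ j, n ≤ j → (Z n ω).1 ≤ (Z j ω).1}

lemma follow_append_subset (v w : List (Fin 3)) : follow Z (v ++ w) ⊆ follow Z v := by
  intro ω h j hj
  have := h j (by rw [List.length_append]; omega)
  rwa [List.take_append_of_le_length hj] at this

lemma posX_of_mem_follow {w : List (Fin 3)} {ω : Ω} (h : ω ∈ follow Z w) :
    ((Z w.length ω).1 : ℤ) = posX w := by
  simpa using (h w.length le_rfl).1

lemma staysNonneg_of_mem_follow {w : List (Fin 3)} {ω : Ω} (h : ω ∈ follow Z w) :
    StaysNonneg w := by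
  intro j hj
  rw [← (h j hj).1]
  positivity

lemma neg_one_le_stepX (a : Fin 3) : -1 ≤ stepX a := by
  revert a
  decide

lemma step_ext {a b : Fin 3} (hx : stepX a = stepX b) : a = b := by
  revert a b
  decide

lemma eq_of_mem_follow {v w : List (Fin 3)} {ω : Ω} (hv : ω ∈ follow Z v) (hw : ω ∈ follow Z w)
    (hlen : v.length = w.length) : v = w := by
  refine List.ext_getElem hlen fun i h1 h2 => step_ext ?_
  have e1 := (hv i h1.le).1
  have e2 := (hw i h2.le).1
  have e3 := (hv (i + 1) h1).1
  have e4 := (hw (i + 1) h2).1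
  rw [List.take_succ_eq_append_getElem h1] at e3
  rw [List.take_succ_eq_append_getElem h2] at e4
  simp only [posX_append, posX_cons, posX_nil] at e3 e4
  omega

lemma staysNonneg_snoc {w : List (Fin 3)} {a : Fin 3} (hw : StaysNonneg w)
    (ha : 0 ≤ posX w + stepX a) : StaysNonneg (w ++ [a]) := by
  refine staysNonneg_append hw fun j hj => ?_
  rcases j with _ | j
  · simpa using hw.posX_nonneg
  · simpa using ha

lemma transProb_step {x : ℤ} (y : ℤ) (a : Fin 3) (hx : 0 ≤ x) (hxa : 0 ≤ x + stepX a) :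
    transProb (x.toNat, y) ((x + stepX a).toNat, y + stepY a) =
      ((x + stepX a : ℤ) + 1 : ℝ) / (3 * (x + 1)) := by
  lift x to ℕ using hx
  obtain rfl | rfl | rfl : a = 0 ∨ a = 1 ∨ a = 2 := by clear hxa; revert a; decide
  · simp only [show stepX 0 = 1 from rfl, show stepY 0 = -1 from rfl]
    rw [transProb, if_pos ⟨by simp, by simp; ring⟩]
    push_cast
    simp only [Int.toNat_natCast]
    ring
  · simp only [show stepX 1 = -1 from rfl, show stepY 1 = 0 from rfl] at hxa ⊢
    rw [transProb, if_neg (fun h => by simp at h; omega), if_pos ⟨by simp; omega, by simp⟩]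
    push_cast
    simp
  · simp only [show stepX 2 = 0 from rfl, show stepY 2 = 1 from rfl]
    rw [transProb, if_neg (fun h => by simp at h), if_neg (fun h => by simp at h),
      if_pos ⟨by simp, by simp⟩]
    have : (x : ℝ) + 1 ≠ 0 := by positivity
    push_cast
    field_simp
    simp

lemma pairwise_disjoint_follow_snoc (w : List (Fin 3)) :
    Pairwise (Function.onFun Disjoint fun a => follow Z (w ++ [a])) := by
  intro a b hab
  refine Set.disjoint_left.2 fun ω ha hb => hab ?_
  simpa using eq_of_mem_follow ha hb (by simp)

lemma eq_of_mem_follow_of_isPrimeRenewal {w u v : List (Fin 3)} {ω : Ω} (hu : IsPrimeRenewal u)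
    (hv : IsPrimeRenewal v) (hωu : ω ∈ follow Z (w ++ u) ∩ futureMin Z (w ++ u).length)
    (hωv : ω ∈ follow Z (w ++ v)) (hlen : u.length ≤ v.length) : u = v := by
  have htake : u = v.take u.length := by
    have h1 : ω ∈ follow Z (w ++ v.take u.length) := by
      have : ω ∈ follow Z ((w ++ v.take u.length) ++ v.drop u.length) := by
        rwa [List.append_assoc, List.take_append_drop]
      exact follow_append_subset _ _ this
    simpa using eq_of_mem_follow hωu.1 h1 (by simp [hlen])
  obtain ⟨r, rfl⟩ : ∃ r, v = u ++ r := by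
    refine ⟨v.drop u.length, ?_⟩
    conv_lhs => rw [← List.take_append_drop u.length v, ← htake]
  by_cases hr : r = []
  · simp [hr]
  have hnonneg : StaysNonneg r := by
    intro j hj
    have h1 := (hωv ((w ++ u).length + j) (by simp; omega)).1
    rw [← List.append_assoc, List.take_length_add_append, posX_append] at h1
    have h2 := posX_of_mem_follow hωu.1
    have h3 := hωu.2 ((w ++ u).length + j) (by omega)
    omega
  exact absurd rfl (hv.2.2 u r hu.2.1 hr hu.1 (isRenewal_right_of_append hv.1 hnonneg))

variable [MeasurableSpace Ω] {P : Measure Ω}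

/-- The finite-dimensional distributions of `Z` are those of the conditioned walk started from
the origin. -/
def IsConditionedWalk (P : Measure Ω) (Z : ℕ → Ω → ℕ × ℤ) : Prop :=
  ∀ (n : ℕ) (p : ℕ → ℕ × ℤ), p 0 = (0, 0) →
    (P {ω | ∀ j ≤ n, Z j ω = p j}).toReal = ∏ j ∈ Finset.range n, transProb (p j) (p (j + 1))

lemma measureReal_follow (hZ : IsConditionedWalk P Z) {w : List (Fin 3)} (hw : StaysNonneg w) :
    P.real (follow Z w) = (posX w + 1) / 3 ^ w.length := by
  set p : ℕ → ℕ × ℤ := fun j => ((posX (w.take j)).toNat, posY (w.take j)) with hp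
  have hset : follow Z w = {ω | ∀ j ≤ w.length, Z j ω = p j} := by
    ext ω
    refine forall₂_congr fun j hj => ?_
    have := hw j hj
    rw [Prod.ext_iff]
    simp only [hp]
    omega
  have hprod : ∀ k ≤ w.length, ∏ j ∈ Finset.range k, transProb (p j) (p (j + 1)) =
      ((posX (w.take k) : ℝ) + 1) / 3 ^ k := by
    intro k
    induction k with
    | zero => simp
    | succ k ih =>
      intro hk
      rw [Finset.prod_range_succ, ih (by omega)]
      have h1 : posX (w.take (k + 1)) = posX (w.take k) + stepX w[k] := by
        rw [List.take_succ_eq_append_getElem hk, posX_append, posX_cons, posX_nil, add_zero]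
      have h2 : posY (w.take (k + 1)) = posY (w.take k) + stepY w[k] := by
        rw [List.take_succ_eq_append_getElem hk, posY_append, posY_cons, posY_nil, add_zero]
      have h3 := hw k (by omega)
      have h4 := hw (k + 1) hk
      simp only [hp]
      rw [h1] at h4 ⊢
      rw [h2, transProb_step _ _ h3 h4]
      have : (0 : ℝ) ≤ posX (w.take k) := by exact_mod_cast h3
      have : (posX (w.take k) : ℝ) + 1 ≠ 0 := by positivity
      field_simp
      ring
  rw [hset, measureReal_def, hZ _ p (by simp [hp]), hprod _ le_rfl, List.take_length]

lemma measurableSet_follow (hm : ∀ n, Measurable (Z n)) (w : List (Fin 3)) :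
    MeasurableSet (follow Z w) := by
  simp only [follow, Set.ofPred_forall]
  exact .iInter fun j => .iInter fun _ =>
    hm j (MeasurableSet.of_discrete
      (s := {q : ℕ × ℤ | (q.1 : ℤ) = posX (w.take j) ∧ q.2 = posY (w.take j)}))

lemma measurableSet_stayAbove (hm : ∀ n, Measurable (Z n)) (c : ℤ) (n M : ℕ) :
    MeasurableSet (stayAbove Z c n M) := by
  simp only [stayAbove, Set.ofPred_forall]
  exact .iInter fun j => .iInter fun _ => .iInter fun _ =>
    hm j (MeasurableSet.of_discrete (s := {q : ℕ × ℤ | c ≤ (q.1 : ℤ)}))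

lemma measurableSet_futureMin (hm : ∀ n, Measurable (Z n)) (n : ℕ) :
    MeasurableSet (futureMin Z n) := by
  simp only [futureMin, Set.ofPred_forall]
  exact .iInter fun j => .iInter fun _ =>
    measurableSet_le (measurable_fst.comp (hm n)) (measurable_fst.comp (hm j))

variable [IsProbabilityMeasure P]

lemma follow_ae_eq_iUnion (hm : ∀ n, Measurable (Z n)) (hZ : IsConditionedWalk P Z)
    (w : List (Fin 3)) : follow Z w =ᵐ[P] ⋃ a, follow Z (w ++ [a]) := by
  symm
  have hsub : ⋃ a, follow Z (w ++ [a]) ⊆ follow Z w :=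
    Set.iUnion_subset fun a => follow_append_subset w [a]
  refine ae_eq_of_subset_of_measure_ge hsub ?_
    (MeasurableSet.iUnion fun a => measurableSet_follow hm _).nullMeasurableSet
    (measure_ne_top _ _)
  by_cases hw : StaysNonneg w
  swap
  · have : follow Z w = ∅ :=
      Set.eq_empty_of_forall_notMem fun ω h => hw (staysNonneg_of_mem_follow h)
    simp [this]
  rw [← ENNReal.toReal_le_toReal (measure_ne_top _ _) (measure_ne_top _ _), ← measureReal_def,
    ← measureReal_def, measureReal_iUnion_fintype
    (pairwise_disjoint_follow_snoc w) fun a => measurableSet_follow hm _]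
  have hstep : ∀ a, P.real (follow Z (w ++ [a])) =
      ((posX w + stepX a : ℤ) + 1) / 3 ^ (w.length + 1) := by
    intro a
    by_cases ha : 0 ≤ posX w + stepX a
    · rw [measureReal_follow hZ (staysNonneg_snoc hw ha)]
      simp
    · have hneg : posX w + stepX a = -1 := by
        have := hw.posX_nonneg
        have := neg_one_le_stepX a
        omega
      have : follow Z (w ++ [a]) = ∅ := by
        refine Set.eq_empty_of_forall_notMem fun ω h => ha ?_
        simpa using (staysNonneg_of_mem_follow h).posX_nonneg
      simp [this, hneg]
  rw [measureReal_follow hZ hw, Finset.sum_congr rfl fun a _ => hstep a, Fin.sum_univ_three]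
  apply le_of_eq
  simp [stepX]
  field_simp
  ring

lemma measureReal_follow_inter (hm : ∀ n, Measurable (Z n)) (hZ : IsConditionedWalk P Z)
    (w : List (Fin 3)) {E : Set Ω} (hE : MeasurableSet E) :
    P.real (follow Z w ∩ E) = ∑ a, P.real (follow Z (w ++ [a]) ∩ E) := by
  rw [measureReal_congr ((follow_ae_eq_iUnion hm hZ w).inter (ae_eq_refl E)), Set.iUnion_inter,
    measureReal_iUnion_fintype _ fun a => (measurableSet_follow hm _).inter hE]
  exact fun a b hab => (pairwise_disjoint_follow_snoc w hab).mono Set.inter_subset_left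
    Set.inter_subset_left

lemma measureReal_follow_inter_stayAbove (hm : ∀ n, Measurable (Z n))
    (hZ : IsConditionedWalk P Z) {c : ℤ} (hc : 0 ≤ c) (M : ℕ) {w : List (Fin 3)}
    (hw : StaysNonneg w) (hcw : c ≤ posX w) :
    P.real (follow Z w ∩ stayAbove Z c w.length M) =
      (posX w - c + 1 + c * survival M (posX w - c)) / 3 ^ w.length := by
  induction M generalizing w with
  | zero =>
    have : follow Z w ∩ stayAbove Z c w.length 0 = follow Z w := by
      refine Set.inter_eq_left.2 fun ω h j h1 h2 => ?_
      obtain rfl : j = w.length := by omega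
      rwa [posX_of_mem_follow h]
    rw [this, measureReal_follow hZ hw]
    simp [survival, hcw]
    ring
  | succ M ih =>
    rw [measureReal_follow_inter hm hZ w (measurableSet_stayAbove hm _ _ _)]
    have hstep : ∀ a, P.real (follow Z (w ++ [a]) ∩ stayAbove Z c w.length (M + 1)) =
        ((posX w + stepX a : ℤ) - c + 1 + c * survival M (posX w + stepX a - c)) /
          3 ^ (w.length + 1) := by
      intro a
      have hset : follow Z (w ++ [a]) ∩ stayAbove Z c w.length (M + 1) =
          follow Z (w ++ [a]) ∩ stayAbove Z c (w ++ [a]).length M := by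
        ext ω
        refine and_congr_right fun hω => ?_
        simp only [stayAbove, Set.mem_ofPred_eq, List.length_append, List.length_singleton]
        refine ⟨fun h j h1 h2 => h j (by omega) (by omega), fun h j h1 h2 => ?_⟩
        rcases eq_or_lt_of_le h1 with rfl | h1
        · rwa [posX_of_mem_follow (follow_append_subset _ _ hω)]
        · exact h j h1 (by omega)
      rw [hset]
      by_cases ha : c ≤ posX w + stepX a
      · rw [ih (staysNonneg_snoc hw (hc.trans ha)) (by simpa using ha)]
        simp
      · have hneg : posX w + stepX a - c = -1 := by
          have := neg_one_le_stepX a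
          omega
        have hempty : follow Z (w ++ [a]) ∩ stayAbove Z c (w ++ [a]).length M = ∅ := by
          refine Set.eq_empty_of_forall_notMem fun ω h => ha ?_
          have := h.2 _ le_rfl (by omega)
          rw [posX_of_mem_follow h.1] at this
          simpa using this
        have hneg' : ((posX w + stepX a : ℤ) : ℝ) - c = -1 := by exact_mod_cast hneg
        rw [hempty, hneg, hneg', survival_of_neg (by norm_num)]
        simp
    have e1 : posX w + 1 - c = posX w - c + 1 := by ring
    have e2 : posX w + -1 - c = posX w - c - 1 := by ring
    rw [Finset.sum_congr rfl fun a _ => hstep a, Fin.sum_univ_three, survival,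
      if_pos (by omega)]
    simp [stepX, e1, e2]
    field_simp
    ring

lemma measure_follow_inter_futureMin (hm : ∀ n, Measurable (Z n)) (hZ : IsConditionedWalk P Z)
    {w : List (Fin 3)} (hw : StaysNonneg w) :
    P (follow Z w ∩ futureMin Z w.length) = weight w := by
  have hset : follow Z w ∩ futureMin Z w.length =
      ⋂ M, follow Z w ∩ stayAbove Z (posX w) w.length M := by
    rw [← Set.inter_iInter]
    ext ω
    refine and_congr_right fun hω => ?_
    simp only [futureMin, stayAbove, Set.mem_ofPred_eq, Set.mem_iInter]
    rw [← posX_of_mem_follow hω]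
    refine ⟨fun h M j h1 _ => by exact_mod_cast h j h1, fun h j hj => ?_⟩
    exact_mod_cast h j j hj (by omega)
  have hanti : Antitone fun M => follow Z w ∩ stayAbove Z (posX w) w.length M :=
    fun M N hMN => Set.inter_subset_inter_right _ fun ω h j h1 h2 => h j h1 (by omega)
  have h1 : Tendsto (fun M => P (follow Z w ∩ stayAbove Z (posX w) w.length M)) atTop
      (𝓝 (P (follow Z w ∩ futureMin Z w.length))) := by
    rw [hset]
    exact tendsto_measure_iInter_atTop (fun M => ((measurableSet_follow hm w).inter
      (measurableSet_stayAbove hm _ _ _)).nullMeasurableSet) hanti ⟨0, measure_ne_top _ _⟩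
  have h2 := (ENNReal.tendsto_toReal (measure_ne_top P _)).comp h1
  have h3 : Tendsto (fun M => P.real (follow Z w ∩ stayAbove Z (posX w) w.length M)) atTop
      (𝓝 ((1 + posX w * 0) / 3 ^ w.length)) := by
    simp only [measureReal_follow_inter_stayAbove hm hZ hw.posX_nonneg _ hw le_rfl, sub_self,
      zero_add]
    exact ((tendsto_survival_zero.const_mul _).const_add _).div_const _
  have h4 := tendsto_nhds_unique h2 h3
  rw [← ENNReal.ofReal_toReal (measure_ne_top P (follow Z w ∩ futureMin Z w.length)), h4]
  rw [weight, mul_zero, add_zero, one_div, ← inv_pow, ENNReal.ofReal_pow (by norm_num),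
    ENNReal.ofReal_inv_of_pos (by norm_num)]
  norm_num

lemma ae_exists_follow (hm : ∀ n, Measurable (Z n)) (hZ : IsConditionedWalk P Z) :
    ∀ᵐ ω ∂P, ∀ n, ∃ w, w.length = n ∧ ω ∈ follow Z w := by
  have h0 : ∀ᵐ ω ∂P, ω ∈ follow Z [] := by
    refine (mem_ae_iff_prob_eq_one (measurableSet_follow hm [])).2 ?_
    have h := measureReal_follow hZ (w := []) (by simp [StaysNonneg])
    rw [← ENNReal.ofReal_toReal (measure_ne_top P _), ← measureReal_def, h]
    simp
  have hs : ∀ᵐ ω ∂P, ∀ w, ω ∈ follow Z w → ∃ a, ω ∈ follow Z (w ++ [a]) := by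
    rw [ae_all_iff]
    intro w
    filter_upwards [(follow_ae_eq_iUnion hm hZ w).mem_iff] with ω hω h
    simpa using hω.1 h
  filter_upwards [h0, hs] with ω h0 hs n
  induction n with
  | zero => exact ⟨[], rfl, h0⟩
  | succ n ih =>
    obtain ⟨w, rfl, hw⟩ := ih
    obtain ⟨a, ha⟩ := hs w hw
    exact ⟨_, by simp, ha⟩

lemma ae_exists_next (hm : ∀ n, Measurable (Z n)) (hZ : IsConditionedWalk P Z)
    {w : List (Fin 3)} (hw : IsRenewal w) :
    ∀ᵐ ω ∂P, ω ∈ follow Z w ∩ futureMin Z w.length →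
      ∃ v, IsPrimeRenewal v ∧ ω ∈ follow Z (w ++ v) ∩ futureMin Z (w ++ v).length := by
  classical
  set U : {v // IsPrimeRenewal v} → Set Ω := fun v =>
    follow Z (w ++ v.1) ∩ futureMin Z (w ++ v.1).length with hU
  have hUm : ∀ v, MeasurableSet (U v) := fun v =>
    (measurableSet_follow hm _).inter (measurableSet_futureMin hm _)
  have hsub : ⋃ v, U v ⊆ follow Z w ∩ futureMin Z w.length := by
    refine Set.iUnion_subset fun v ω hω => ⟨follow_append_subset _ _ hω.1, fun j hj => ?_⟩
    have e0 := posX_of_mem_follow (follow_append_subset _ _ hω.1)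
    rcases le_total (w ++ v.1).length j with h | h
    · have e1 := hω.2 j h
      have e2 := posX_of_mem_follow hω.1
      have e3 := v.2.1.1.posX_nonneg
      rw [posX_append] at e2
      omega
    · obtain ⟨i, rfl⟩ := Nat.exists_eq_add_of_le hj
      have e1 := (hω.1 _ h).1
      rw [List.take_length_add_append, posX_append] at e1
      rw [List.length_append] at h
      have e2 := v.2.1.1 i (by omega)
      omega
  have hdisj : Pairwise (Function.onFun Disjoint U) := by
    intro u v huv
    refine Set.disjoint_left.2 fun ω h1 h2 => huv (Subtype.ext ?_)
    rcases le_total u.1.length v.1.length with h | h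
    · exact eq_of_mem_follow_of_isPrimeRenewal u.2 v.2 h1 h2.1 h
    · exact (eq_of_mem_follow_of_isPrimeRenewal v.2 u.2 h2 h1.1 h).symm
  have hle : P (follow Z w ∩ futureMin Z w.length) ≤ P (⋃ v, U v) := by
    rw [measure_iUnion hdisj hUm, measure_follow_inter_futureMin hm hZ hw.1]
    have : ∀ v, P (U v) = weight w * weight v.1 := fun v => by
      rw [← weight_append]
      exact measure_follow_inter_futureMin hm hZ (isRenewal_append hw v.2.1).1
    simp only [this]
    rw [ENNReal.tsum_mul_left]
    have hF := one_le_tsum_isPrimeRenewal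
    rw [show (∑' v : {v // IsPrimeRenewal v}, weight v.1) =
      ∑' v, (if IsPrimeRenewal v then weight v else 0) from tsum_subtype {v | IsPrimeRenewal v} _]
    exact le_mul_of_one_le_right zero_le hF
  have hae := ae_eq_of_subset_of_measure_ge hsub hle
    (MeasurableSet.iUnion hUm).nullMeasurableSet (measure_ne_top _ _)
  filter_upwards [hae.mem_iff] with ω hω h
  obtain ⟨v, hv⟩ := Set.mem_iUnion.1 (hω.2 h)
  exact ⟨v.1, v.2, hv⟩

/-- Times at which the second coordinate attains a strict running minimum and the first one a
future minimum. -/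
def cutTimes (Z : ℕ → Ω → ℕ × ℤ) (ω : Ω) : Set ℕ :=
  {n | 1 ≤ n ∧ (∀ j < n, (Z n ω).2 ≤ (Z j ω).2 - 1) ∧
    ∀ j : ℕ, n ≤ j → (Z n ω).1 ≤ (Z j ω).1}

lemma ae_infinite_cutTimes (hm : ∀ n, Measurable (Z n)) (hZ : IsConditionedWalk P Z) :
    ∀ᵐ ω ∂P, (cutTimes Z ω).Infinite := by
  have hnext : ∀ᵐ ω ∂P, ∀ w, IsRenewal w → ω ∈ follow Z w ∩ futureMin Z w.length →
      ∃ v, IsPrimeRenewal v ∧ ω ∈ follow Z (w ++ v) ∩ futureMin Z (w ++ v).length := by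
    rw [ae_all_iff]
    intro w
    by_cases hw : IsRenewal w
    · filter_upwards [ae_exists_next hm hZ hw] with ω h _ using h
    · exact .of_forall fun ω h => absurd h hw
  filter_upwards [ae_exists_follow hm hZ, hnext] with ω hfollow hnext
  have hlong : ∀ n, ∃ w, n < w.length ∧ IsRenewal w ∧
      ω ∈ follow Z w ∩ futureMin Z w.length := by
    have hstep : ∀ w, IsRenewal w → ω ∈ follow Z w ∩ futureMin Z w.length →
        ∃ w', w.length < w'.length ∧ IsRenewal w' ∧
          ω ∈ follow Z w' ∩ futureMin Z w'.length := by
      intro w hw hω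
      obtain ⟨v, hv, hωv⟩ := hnext w hw hω
      have := List.length_pos_iff.2 hv.2.1
      exact ⟨w ++ v, by rw [List.length_append]; omega, isRenewal_append hw hv.1, hωv⟩
    intro n
    induction n with
    | zero =>
      refine hstep [] ⟨by simp [StaysNonneg], by simp⟩ ?_
      obtain ⟨w, hw, hω⟩ := hfollow 0
      obtain rfl := List.length_eq_zero_iff.1 hw
      refine ⟨hω, fun j _ => ?_⟩
      have := posX_of_mem_follow hω
      simp at this
      simp [this]
    | succ n ih =>
      obtain ⟨w, h1, h2, h3⟩ := ih
      obtain ⟨w', h1', h2'⟩ := hstep w h2 h3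
      exact ⟨w', by omega, h2'⟩
  refine Set.infinite_of_forall_exists_gt fun n => ?_
  obtain ⟨w, hn, hr, hω, hf⟩ := hlong n
  refine ⟨w.length, ⟨by omega, fun j hj => ?_, hf⟩, hn⟩
  have h1 := (hω j hj.le).2
  have h2 := (hω w.length le_rfl).2
  rw [List.take_length] at h2
  have h3 := hr.2 j hj
  omega

end Chain

end BipolarWalk

/-- Start the chain `Ẑ = (L̂, R̂)` from `(0,0)`.  With
`A n = {R̂ n ≤ R̂ j - 1 for all 0 ≤ j ≤ n-1}` and `B n = {L̂ j ≥ L̂ n for all j ≥ n}`,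
almost surely there are infinitely many `n ≥ 1` for which `A n ∩ B n` occurs.
(Equivalently: the UIQBOT a.s. has infinitely many cut vertices.) -/
theorem stmt_5
    {Ω : Type*} [MeasurableSpace Ω] (P : Measure Ω) [IsProbabilityMeasure P]
    (Zhat : ℕ → Ω → ℕ × ℤ)
    (hMeas : ∀ n, Measurable (Zhat n))
    (hPath : ∀ (n : ℕ) (p : ℕ → ℕ × ℤ), p 0 = (0, 0) →
      (P {ω | ∀ j ≤ n, Zhat j ω = p j}).toReal =
        ∏ j ∈ Finset.range n, transProb (p j) (p (j + 1))) :
    P {ω | {n : ℕ | 1 ≤ n ∧ (∀ j < n, (Zhat n ω).2 ≤ (Zhat j ω).2 - 1) ∧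
        (∀ j : ℕ, n ≤ j → (Zhat n ω).1 ≤ (Zhat j ω).1)}.Infinite} = 1 := by
  exact (measure_congr (eventuallyEq_univ.2
    (BipolarWalk.ae_infinite_cutTimes hMeas hPath))).trans measure_univ
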